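/- With the notation of the context, there exist polynomials b : Fin (n+1) → MvPolynomial (Fin n) ℂ such that ∑_{i : Fin (n+1)} b i * h i = 1 in MvPolynomial (Fin n) ℂ. -/

import Mathlib

open MvPolynomial

/-- `x 0 = 1 - ∑ j, X j` and `x (i+1) = X i`. -/
noncomputable def xP (n : ℕ) (i : Fin (n + 1)) : MvPolynomial (Fin n) ℂ :=
  Fin.cases (1 - ∑ j : Fin n, X j) (fun j => X j) i

/-- `Y i = ∑_{j : Fin n, i ≤ j} X j`. -/
noncomputable def YP (n : ℕ) (i : Fin (n + 1)) : MvPolynomial (Fin n) ℂ :=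
  ∑ j ∈ Finset.univ.filter (fun j : Fin n => (i : ℕ) ≤ (j : ℕ)), X j

/-- `h i = ∏_{k=1}^{p i} (x i + C(1 - q^(2k)) Y i)`, representing `ζ_i^* ζ_i`. -/
noncomputable def hP (n : ℕ) (q : ℝ) (p : Fin (n + 1) → ℕ) (i : Fin (n + 1)) :
    MvPolynomial (Fin n) ℂ :=
  ∏ k ∈ Finset.Icc 1 (p i),
    (xP n i + C (1 - (q : ℂ) ^ (2 * k)) * YP n i)

/-- `x 0 + Y 0 = 1`. -/
lemma xP_zero_add (n : ℕ) : xP n 0 + YP n 0 = 1 := by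
  simp [xP, YP]

/-- `x (i+1) + Y (i+1) = Y i`. -/
lemma xP_succ_add (n : ℕ) (i : Fin n) : xP n i.succ + YP n i.succ = YP n i.castSucc := by
  have h : (Finset.univ.filter (fun j : Fin n => ((i.castSucc : Fin (n + 1)) : ℕ) ≤ (j : ℕ)))
      = insert i (Finset.univ.filter (fun j : Fin n => ((i.succ : Fin (n + 1)) : ℕ) ≤ (j : ℕ))) := by
    ext j
    simp only [Finset.mem_filter, Finset.mem_univ, true_and, Finset.mem_insert, Fin.ext_iff,
      Fin.val_castSucc, Fin.val_succ]
    omega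
  unfold YP
  rw [h, Finset.sum_insert (by simp)]
  simp [xP]

/-- If a prime ideal contains `h i` and `Y i`, it contains `x i + Y i`. -/
lemma step_mem (n : ℕ) (q : ℝ) (p : Fin (n + 1) → ℕ) (M : Ideal (MvPolynomial (Fin n) ℂ))
    [M.IsPrime] (i : Fin (n + 1)) (h : hP n q p i ∈ M) (hY : YP n i ∈ M) :
    xP n i + YP n i ∈ M := by
  unfold hP at h
  obtain ⟨k, -, hk⟩ := (Ideal.IsPrime.prod_mem_iff (p := M)).1 h
  have := M.sub_mem hk (M.mul_mem_left (C (1 - (q : ℂ) ^ (2 * k))) hY)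
  rw [add_sub_cancel_right] at this
  exact M.add_mem this hY

/-- There exist polynomials `b i` with `∑ i, b i * h i = 1`. -/
theorem exists_combination_hP (n : ℕ) (hn : 1 ≤ n) (q : ℝ) (hq0 : 0 < q) (hq1 : q < 1)
    (p : Fin (n + 1) → ℕ) (hp : ∀ i, 1 ≤ p i) :
    ∃ b : Fin (n + 1) → MvPolynomial (Fin n) ℂ,
      ∑ i : Fin (n + 1), b i * hP n q p i = 1 := by
  have key : Ideal.span (Set.range (hP n q p)) = ⊤ := by
    by_contra hne
    obtain ⟨M, hM, hle⟩ := Ideal.exists_le_maximal _ hne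
    have hpr : M.IsPrime := hM.isPrime
    have hmem : ∀ i, hP n q p i ∈ M := fun i => hle (Ideal.subset_span ⟨i, rfl⟩)
    have hY : ∀ i : Fin (n + 1), YP n i ∉ M := by
      intro i
      induction i using Fin.induction with
      | zero =>
        intro h
        have := step_mem n q p M 0 (hmem 0) h
        rw [xP_zero_add] at this
        exact hpr.ne_top ((Ideal.eq_top_iff_one M).2 this)
      | succ i ih =>
        intro h
        have := step_mem n q p M i.succ (hmem _) h
        rw [xP_succ_add] at this
        exact ih this
    apply hY (Fin.last n)
    have : YP n (Fin.last n) = 0 := by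
      unfold YP
      rw [Finset.filter_false_of_mem, Finset.sum_empty]
      intro j _
      simp
    rw [this]
    exact M.zero_mem
  have h1 : (1 : MvPolynomial (Fin n) ℂ) ∈ Ideal.span (Set.range (hP n q p)) := by
    rw [key]; trivial
  exact Ideal.mem_span_range_iff_exists_fun.1 h1
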